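/- arXiv:2411.15545 — 2 statements merged into one kernel-verified Lean document; each statement's English description precedes it below -/
import Mathlib

section
/- If an n-qubit stabilizer state |a⟩ factors as a tensor product |a⟩ = |b⟩ ⊗ |c⟩ across a bipartition of the qubits, then |b⟩ and |c⟩ are stabilizer states on their respective qubit sets. -/
/-- A vector is a stabilizer-state coefficient vector (real form) if it has exactly
`2 ^ l` nonzero entries, all equal to `±z` for a single nonzero constant `z`
(the constant `z` absorbs the normalization `2^{-l/2}` and a global phase). -/
def IsStabCoeffVec {α : Type*} [Fintype α] (v : α → ℂ) : Prop :=
  ∃ (l : ℕ) (z : ℂ), z ≠ 0 ∧ {x | v x ≠ 0}.ncard = 2 ^ l ∧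
    ∀ x, v x = 0 ∨ v x = z ∨ v x = -z

theorem IsStabCoeffVec.comp_equiv {α β : Type*} [Fintype α] [Fintype β] {v : α → ℂ}
    (hv : IsStabCoeffVec v) (e : β ≃ α) : IsStabCoeffVec (v ∘ e) := by
  obtain ⟨l, z, hz, hcard, hval⟩ := hv
  refine ⟨l, z, hz, ?_, fun x => hval (e x)⟩
  rw [← hcard]
  exact Set.ncard_preimage_of_injective_subset_range (s := {x | v x ≠ 0}) e.injective (by simp)

theorem IsStabCoeffVec.of_tensor_left {p q : Type*} [Fintype p] [Fintype q]
    {b : p → ℂ} {c : q → ℂ} (hc : c ≠ 0)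
    (ha : IsStabCoeffVec (fun x : p × q => b x.1 * c x.2)) : IsStabCoeffVec b := by
  obtain ⟨l, z, hz, hcard, hval⟩ := ha
  obtain ⟨y, hy⟩ := Function.ne_iff.mp hc
  have hy : c y ≠ 0 := hy
  have hsupp : {x : p × q | b x.1 * c x.2 ≠ 0} = {x | b x ≠ 0} ×ˢ {x | c x ≠ 0} := by
    ext x
    simp
  rw [hsupp, Set.ncard_prod] at hcard
  obtain ⟨k, -, hk⟩ := (Nat.dvd_prime_pow Nat.prime_two).mp (Dvd.intro _ hcard)
  refine ⟨k, z / c y, div_ne_zero hz hy, hk, fun x => ?_⟩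
  rw [← neg_div, eq_div_iff hy, eq_div_iff hy]
  exact (hval (x, y)).imp_left fun h => (mul_eq_zero.mp h).resolve_right hy

/-- If a stabilizer state `a` factors as a tensor product
`a = b ⊗ c` across a bipartition of the qubits, then `b` and `c` are stabilizer
states on their respective qubit sets. -/
theorem stmt7 {p q : Type*} [Fintype p] [Fintype q]
    (b : p → ℂ) (c : q → ℂ) (hb : b ≠ 0) (hc : c ≠ 0)
    (ha : IsStabCoeffVec (fun x : p × q => b x.1 * c x.2)) :
    IsStabCoeffVec b ∧ IsStabCoeffVec c := by
  refine ⟨ha.of_tensor_left hc, IsStabCoeffVec.of_tensor_left (c := b) hb ?_⟩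
  simpa only [Function.comp_def, Equiv.prodComm_apply, Prod.fst_swap, Prod.snd_swap, mul_comm]
    using ha.comp_equiv (Equiv.prodComm q p)
end

section
/- A stabilizer state is separable across a bipartition (A,B) if and only if its tableau (binary symplectic) representation can be brought, by row operations (choice of generators), to block-diagonal form: [X'_A 0 | Z'_A 0] stacked over [0 X''_B | 0 Z''_B]. -/
open Matrix

/-- The four single-qubit Pauli matrices `I, X, Y, Z` indexed by `Fin 4`. -/
def pauliMat : Fin 4 → Matrix (Fin 2) (Fin 2) ℂ :=
  ![1, !![0, 1; 1, 0], !![0, -Complex.I; Complex.I, 0], !![1, 0; 0, -1]]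

/-- The `n`-qubit Pauli string (tensor product of single-qubit Paulis) described by
`p : Fin n → Fin 4`, realized as a matrix on `(Fin n → Fin 2)`. -/
def pauliOp {n : ℕ} (p : Fin n → Fin 4) :
    Matrix (Fin n → Fin 2) (Fin n → Fin 2) ℂ :=
  Matrix.of fun i j => ∏ k, pauliMat (p k) (i k) (j k)

/-- The stabilizer group of a state `v`: all signed Pauli strings fixing `v`. -/
def stabSet {n : ℕ} (v : (Fin n → Fin 2) → ℂ) :
    Set (Matrix (Fin n → Fin 2) (Fin n → Fin 2) ℂ) :=
  {σ | (∃ (ε : ℂ) (p : Fin n → Fin 4), (ε = 1 ∨ ε = -1) ∧ σ = ε • pauliOp p) ∧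
    σ.mulVec v = v}

/-- `v` factors as a tensor product across the bipartition `(A, Aᶜ)` of the qubits. -/
def SeparableAcross {n : ℕ} (v : (Fin n → Fin 2) → ℂ) (A : Set (Fin n)) : Prop :=
  ∃ (b : (↥A → Fin 2) → ℂ) (c : (↥Aᶜ → Fin 2) → ℂ),
    ∀ x : Fin n → Fin 2, v x = b (fun i => x i.1) * c (fun i => x i.1)

open scoped Kronecker

/-- The tensor product of a family of single-qubit matrices. -/
def tensorMat {ι : Type*} [Fintype ι] (M : ι → Matrix (Fin 2) (Fin 2) ℂ) :
    Matrix (ι → Fin 2) (ι → Fin 2) ℂ :=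
  Matrix.of fun i j => ∏ k, M k (i k) (j k)

section tensorMat

variable {ι : Type*} [Fintype ι]

theorem tensorMat_mul [DecidableEq ι] (M N : ι → Matrix (Fin 2) (Fin 2) ℂ) :
    tensorMat M * tensorMat N = tensorMat fun k => M k * N k := by
  ext i j
  simp only [tensorMat, Matrix.mul_apply, Matrix.of_apply, ← Finset.prod_mul_distrib]
  rw [Fintype.prod_sum]

theorem tensorMat_one : tensorMat (fun _ : ι => 1) = 1 := by
  ext i j
  simp only [tensorMat, Matrix.of_apply, Matrix.one_apply]
  by_cases h : i = j
  · simp [h]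
  · obtain ⟨k, hk⟩ := Function.ne_iff.mp h
    rw [if_neg h]
    exact Finset.prod_eq_zero (Finset.mem_univ k) (by simp [hk])

theorem tensorMat_smul (c : ι → ℂ) (M : ι → Matrix (Fin 2) (Fin 2) ℂ) :
    tensorMat (fun k => c k • M k) = (∏ k, c k) • tensorMat M := by
  ext i j
  simp [tensorMat, Finset.prod_mul_distrib]

theorem trace_tensorMat [DecidableEq ι] (M : ι → Matrix (Fin 2) (Fin 2) ℂ) :
    (tensorMat M).trace = ∏ k, (M k).trace := by
  simp only [tensorMat, Matrix.trace, Matrix.diag, Matrix.of_apply]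
  rw [Fintype.prod_sum]

end tensorMat

theorem pauliMat_mul_self (a : Fin 4) : pauliMat a * pauliMat a = 1 := by
  fin_cases a <;> ext i j <;> fin_cases i <;> fin_cases j <;>
    simp [pauliMat, Matrix.mul_apply]

theorem trace_pauliMat {a : Fin 4} (ha : a ≠ 0) : (pauliMat a).trace = 0 := by
  fin_cases a <;> simp_all [pauliMat, Matrix.trace]

theorem exists_pauliMat_mul (a b : Fin 4) :
    ∃ (c : Fin 4) (φ : ℂ), pauliMat a * pauliMat b = φ • pauliMat c := by
  refine ⟨!![0, 1, 2, 3; 1, 0, 3, 2; 2, 3, 0, 1; 3, 2, 1, 0] a b,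
    !![1, 1, 1, 1; 1, 1, Complex.I, -Complex.I; 1, -Complex.I, 1, Complex.I;
      1, Complex.I, -Complex.I, 1] a b, ?_⟩
  fin_cases a <;> fin_cases b <;> ext i j <;> fin_cases i <;> fin_cases j <;>
    simp [pauliMat, Matrix.mul_apply]

theorem pauliMat_mul_comm (a b : Fin 4) :
    ∃ s : ℂ, (s = 1 ∨ s = -1) ∧ pauliMat a * pauliMat b = s • (pauliMat b * pauliMat a) := by
  refine ⟨!![1, 1, 1, 1; 1, 1, -1, -1; 1, -1, 1, -1; 1, -1, -1, 1] a b, ?_, ?_⟩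
  · fin_cases a <;> fin_cases b <;> simp
  · fin_cases a <;> fin_cases b <;> ext i j <;> fin_cases i <;> fin_cases j <;>
      simp [pauliMat, Matrix.mul_apply]

section pauliOp

variable {n : ℕ}

theorem pauliOp_eq_tensorMat (p : Fin n → Fin 4) :
    pauliOp p = tensorMat fun k => pauliMat (p k) := rfl

theorem pauliOp_mul_self (p : Fin n → Fin 4) : pauliOp p * pauliOp p = 1 := by
  simp only [pauliOp_eq_tensorMat, tensorMat_mul, pauliMat_mul_self, tensorMat_one]

theorem pauliOp_zero : pauliOp (0 : Fin n → Fin 4) = 1 := tensorMat_one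

theorem trace_pauliOp {p : Fin n → Fin 4} (hp : p ≠ 0) : (pauliOp p).trace = 0 := by
  obtain ⟨k, hk⟩ := Function.ne_iff.mp hp
  rw [pauliOp_eq_tensorMat, trace_tensorMat]
  exact Finset.prod_eq_zero (Finset.mem_univ k) (trace_pauliMat hk)

theorem exists_pauliOp_mul (p q : Fin n → Fin 4) :
    ∃ (r : Fin n → Fin 4) (φ : ℂ), pauliOp p * pauliOp q = φ • pauliOp r := by
  choose r φ h using fun k => exists_pauliMat_mul (p k) (q k)
  exact ⟨r, ∏ k, φ k, by simp only [pauliOp_eq_tensorMat, tensorMat_mul, h, tensorMat_smul]⟩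

theorem pauliOp_mul_comm (p q : Fin n → Fin 4) :
    ∃ s : ℂ, (s = 1 ∨ s = -1) ∧ pauliOp p * pauliOp q = s • (pauliOp q * pauliOp p) := by
  choose s hs h using fun k => pauliMat_mul_comm (p k) (q k)
  refine ⟨∏ k, s k, mul_self_eq_one_iff.mp ?_, ?_⟩
  · rw [← Finset.prod_mul_distrib]
    exact Finset.prod_eq_one fun k _ => mul_self_eq_one_iff.mpr (hs k)
  · simp only [pauliOp_eq_tensorMat, tensorMat_mul, h, tensorMat_smul]

end pauliOp

section stabSet

variable {n : ℕ} {v : (Fin n → Fin 2) → ℂ}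

theorem one_mem_stabSet : (1 : Matrix (Fin n → Fin 2) (Fin n → Fin 2) ℂ) ∈ stabSet v :=
  ⟨⟨1, 0, Or.inl rfl, by rw [pauliOp_zero, one_smul]⟩, Matrix.one_mulVec v⟩

theorem mul_self_of_mem_stabSet {σ : Matrix (Fin n → Fin 2) (Fin n → Fin 2) ℂ}
    (hσ : σ ∈ stabSet v) : σ * σ = 1 := by
  obtain ⟨⟨ε, p, hε, rfl⟩, -⟩ := hσ
  rw [smul_mul_smul_comm, pauliOp_mul_self, mul_self_eq_one_iff.mpr hε, one_smul]

theorem mul_comm_of_mem_stabSet (hv : v ≠ 0)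
    {σ τ : Matrix (Fin n → Fin 2) (Fin n → Fin 2) ℂ}
    (hσ : σ ∈ stabSet v) (hτ : τ ∈ stabSet v) : Commute σ τ := by
  obtain ⟨⟨ε, p, hε, hp⟩, hσv⟩ := hσ
  obtain ⟨⟨δ, q, hδ, hq⟩, hτv⟩ := hτ
  obtain ⟨s, -, h⟩ := pauliOp_mul_comm p q
  have hs : σ * τ = s • (τ * σ) := by
    rw [hp, hq, smul_mul_smul_comm, smul_mul_smul_comm, h, smul_smul, smul_smul]
    congr 1
    ring
  have hsv : v = s • v := by
    have := congrArg (fun M => M *ᵥ v) hs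
    simpa only [Matrix.smul_mulVec, ← Matrix.mulVec_mulVec, hσv, hτv] using this
  have hs1 : s = 1 := by
    have h0 : (s - 1) • v = 0 := by rw [sub_smul, one_smul, ← hsv, sub_self]
    exact sub_eq_zero.mp ((smul_eq_zero.mp h0).resolve_right hv)
  rw [commute_iff_eq, hs, hs1, one_smul]

theorem mul_mem_stabSet (hv : v ≠ 0) {σ τ : Matrix (Fin n → Fin 2) (Fin n → Fin 2) ℂ}
    (hσ : σ ∈ stabSet v) (hτ : τ ∈ stabSet v) : σ * τ ∈ stabSet v := by
  have hfix : (σ * τ) *ᵥ v = v := by rw [← Matrix.mulVec_mulVec, hτ.2, hσ.2]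
  have hsq : σ * τ * (σ * τ) = 1 := by
    rw [(mul_comm_of_mem_stabSet hv hτ hσ).mul_mul_mul_comm, mul_self_of_mem_stabSet hσ,
      mul_self_of_mem_stabSet hτ, one_mul]
  obtain ⟨⟨ε, p, hε, hp⟩, -⟩ := hσ
  obtain ⟨⟨δ, q, hδ, hq⟩, -⟩ := hτ
  obtain ⟨r, φ, hr⟩ := exists_pauliOp_mul p q
  have heq : σ * τ = (ε * δ * φ) • pauliOp r := by
    rw [hp, hq, smul_mul_smul_comm, hr, smul_smul]
  refine ⟨⟨_, r, mul_self_eq_one_iff.mp ?_, heq⟩, hfix⟩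
  rw [heq, smul_mul_smul_comm, pauliOp_mul_self] at hsq
  simpa using congrFun (congrFun hsq 0) 0

/-- The stabilizer group of a nonzero vector, as a submonoid of the matrix algebra. -/
def stabSubmonoid (hv : v ≠ 0) : Submonoid (Matrix (Fin n → Fin 2) (Fin n → Fin 2) ℂ) where
  carrier := stabSet v
  one_mem' := one_mem_stabSet
  mul_mem' := mul_mem_stabSet hv

/-- The stabilizer group of a nonzero vector is commutative, each element being its own inverse. -/
noncomputable abbrev stabCommGroup (hv : v ≠ 0) : CommGroup (stabSubmonoid hv) :=
  { (inferInstance : Monoid (stabSubmonoid hv)) with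
    inv := id
    inv_mul_cancel := fun σ => Subtype.ext (mul_self_of_mem_stabSet σ.2)
    mul_comm := fun σ τ => Subtype.ext (mul_comm_of_mem_stabSet hv σ.2 τ.2) }

theorem trace_of_mem_stabSet (hv : v ≠ 0) {σ : Matrix (Fin n → Fin 2) (Fin n → Fin 2) ℂ}
    (hσ : σ ∈ stabSet v) (h1 : σ ≠ 1) : σ.trace = 0 := by
  obtain ⟨⟨ε, p, hε, rfl⟩, hfix⟩ := hσ
  by_cases hp : p = 0
  · subst hp
    rw [pauliOp_zero] at hfix h1
    obtain rfl | rfl := hε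
    · simp at h1
    · rw [Matrix.smul_mulVec, Matrix.one_mulVec, neg_smul, one_smul] at hfix
      exact absurd (self_eq_neg.mp hfix.symm) hv
  · rw [Matrix.trace_smul, trace_pauliOp hp, smul_zero]

end stabSet

theorem exists_subset_prod_generators {G : Type*} [CommGroup G] (hsq : ∀ x : G, x * x = 1)
    {n : ℕ} (hcard : Nat.card G = 2 ^ n) {T : Set G} (hT : Subgroup.closure T = ⊤) :
    ∃ g : Fin n → G, (∀ i, g i ∈ T) ∧
      ∀ x, ∃ f : Fin n → Bool, x = ∏ i, if f i then g i else 1 := by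
  have hbit : ∀ c : ZMod 2, c = 0 ∨ c = 1 := by decide
  have : Finite G := Nat.finite_of_card_ne_zero (by rw [hcard]; positivity)
  have : Fact (Nat.Prime 2) := ⟨Nat.prime_two⟩
  let : Module (ZMod 2) (Additive G) := AddCommGroup.zmodModule fun x => by
    rw [two_nsmul]
    exact hsq x.toMul
  have hspan : ⊤ ≤ Submodule.span (ZMod 2) (Additive.toMul ⁻¹' T) := by
    intro x _
    have hle : Subgroup.closure T ≤ AddSubgroup.toSubgroup'
        (Submodule.span (ZMod 2) (Additive.toMul ⁻¹' T)).toAddSubgroup :=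
      (Subgroup.closure_le _).mpr fun y hy => Submodule.subset_span (s := Additive.toMul ⁻¹' T) hy
    exact hle (hT ▸ Subgroup.mem_top x.toMul)
  have hrank : Module.finrank (ZMod 2) (Additive G) = n := by
    have h := Module.natCard_eq_pow_finrank (K := ZMod 2) (V := Additive G)
    rw [Nat.card_congr Additive.toMul, hcard, Nat.card_zmod] at h
    exact (Nat.pow_right_injective le_rfl h).symm
  obtain ⟨b, hb⟩ : ∃ b : Module.Basis (Fin n) (ZMod 2) (Additive G), ∀ i, (b i).toMul ∈ T := by
    let b := Module.Basis.ofSpan hspan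
    have : Fintype ((linearIndepOn_empty (ZMod 2) id).extend
        (Set.empty_subset (Additive.toMul ⁻¹' T))) := Fintype.ofFinite _
    refine ⟨b.reindex (Fintype.equivFinOfCardEq
      ((Module.finrank_eq_card_basis b).symm.trans hrank)), fun i => ?_⟩
    rw [Module.Basis.reindex_apply]
    exact Module.Basis.ofSpan_subset hspan (Set.mem_range_self _)
  refine ⟨fun i => (b i).toMul, hb, fun x => ⟨fun i => b.repr (.ofMul x) i = 1, ?_⟩⟩
  have hx := congrArg Additive.toMul (b.sum_repr (.ofMul x))
  rw [toMul_sum, toMul_ofMul] at hx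
  refine hx.symm.trans (Finset.prod_congr rfl fun i _ => ?_)
  obtain h | h := hbit (b.repr (.ofMul x) i) <;> simp [h]

theorem prod_ofFn_one_add {R : Type*} [Semiring R] {n : ℕ} (g : Fin n → R) :
    (List.ofFn fun i => 1 + g i).prod =
      ∑ f : Fin n → Bool, (List.ofFn fun i => if f i then g i else 1).prod := by
  induction n with
  | zero => simp
  | succ n ih =>
    rw [← (Fin.consEquiv fun _ : Fin (n + 1) => Bool).sum_comp, Fintype.sum_prod_type]
    simp [List.ofFn_succ, Fin.consEquiv, ih, ← Finset.mul_sum, add_mul, add_comm (∑ _, _)]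

theorem exists_vecMulVec_of_trace_eq_one {m : Type*} [Fintype m] [DecidableEq m]
    {P : Matrix m m ℂ} (hP : IsIdempotentElem P) (htr : P.trace = 1) {v : m → ℂ} (hv : v ≠ 0)
    (hPv : P *ᵥ v = v) : ∃ w, P = Matrix.vecMulVec v w := by
  have hidem : IsIdempotentElem (Matrix.toLin' P) := by
    rw [IsIdempotentElem, Module.End.mul_eq_comp, ← Matrix.toLin'_mul, hP.eq]
  have hrank : Module.finrank ℂ (LinearMap.range (Matrix.toLin' P)) = 1 := by
    have h := (LinearMap.IsIdempotentElem.isProj_range _ hidem).trace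
    rw [Matrix.trace_toLin'_eq, htr] at h
    exact_mod_cast h.symm
  let v' : LinearMap.range (Matrix.toLin' P) := ⟨v, v, by simpa using hPv⟩
  have hv' : v' ≠ 0 := fun h => hv (congrArg Subtype.val h)
  have hspan := (finrank_eq_one_iff_of_nonzero' v' hv').mp hrank
  choose w hw using fun j => hspan ⟨P *ᵥ Pi.single j 1, _, Matrix.toLin'_apply _ _⟩
  refine ⟨w, ?_⟩
  ext i j
  have := congrFun (congrArg Subtype.val (hw j)) i
  simp only [Matrix.mulVec_single_one, Matrix.col_apply] at this
  rw [Matrix.vecMulVec_apply, ← this, mul_comm]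
  rfl

section stabSum

variable {n : ℕ} {v : (Fin n → Fin 2) → ℂ}

theorem natCard_stabSubmonoid (hv : v ≠ 0) :
    Nat.card (stabSubmonoid hv) = (stabSet v).ncard :=
  Nat.card_coe_set_eq (stabSet v)

theorem exists_sum_stabSubmonoid_eq_vecMulVec (hv : v ≠ 0) [Fintype (stabSubmonoid hv)]
    (hcard : (stabSet v).ncard = 2 ^ n) :
    ∃ w, w ≠ 0 ∧ ∑ σ : stabSubmonoid hv, σ.1 = Matrix.vecMulVec v w := by
  let := stabCommGroup hv
  set Q := ∑ σ : stabSubmonoid hv, σ.1 with hQ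
  have hcard' : (Fintype.card (stabSubmonoid hv) : ℂ) = 2 ^ n := by
    rw [← Nat.card_eq_fintype_card, natCard_stabSubmonoid, hcard]
    push_cast
    rfl
  have h2 : (2 : ℂ) ^ n ≠ 0 := pow_ne_zero n two_ne_zero
  have hσQ (σ : stabSubmonoid hv) : σ.1 * Q = Q := by
    rw [hQ, Finset.mul_sum]
    exact Fintype.sum_equiv (Equiv.mulLeft σ) _ _ fun τ => rfl
  have hQQ : Q * Q = (2 : ℂ) ^ n • Q := by
    conv_lhs => rw [hQ]
    rw [Finset.sum_mul, ← hQ, Finset.sum_congr rfl fun σ _ => hσQ σ, Finset.sum_const,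
      Finset.card_univ, ← hcard', Nat.cast_smul_eq_nsmul]
  have hQv : Q *ᵥ v = (2 : ℂ) ^ n • v := by
    rw [hQ, Matrix.sum_mulVec, Finset.sum_congr rfl fun σ _ => σ.2.2, Finset.sum_const,
      Finset.card_univ, ← hcard', Nat.cast_smul_eq_nsmul]
  have htr : Q.trace = 2 ^ n := by
    rw [hQ, Matrix.trace_sum, Fintype.sum_eq_single (1 : stabSubmonoid hv) fun σ hσ =>
      trace_of_mem_stabSet hv σ.2 fun h => hσ (Subtype.ext h)]
    simp
  obtain ⟨w, hw⟩ := exists_vecMulVec_of_trace_eq_one (P := ((2 : ℂ) ^ n)⁻¹ • Q) (v := v)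
    (by rw [IsIdempotentElem, smul_mul_smul_comm, hQQ, smul_smul, mul_assoc,
      inv_mul_cancel₀ h2, mul_one])
    (by rw [Matrix.trace_smul, htr, smul_eq_mul, inv_mul_cancel₀ h2]) hv
    (by rw [Matrix.smul_mulVec, hQv, inv_smul_smul₀ h2])
  have hQw : Q = Matrix.vecMulVec v ((2 : ℂ) ^ n • w) := by
    rw [Matrix.vecMulVec_smul, ← hw, smul_inv_smul₀ h2]
  refine ⟨_, fun h0 => ?_, hQw⟩
  rw [hQw, h0, Matrix.vecMulVec_zero, Matrix.zero_mulVec] at hQv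
  exact smul_ne_zero h2 hv hQv.symm

end stabSum

section bipartite

variable {n : ℕ} (A : Set (Fin n)) [DecidablePred (· ∈ A)]

/-- A computational basis index restricted to both sides of a bipartition. -/
def splitEquiv : (Fin n → Fin 2) ≃ (↥A → Fin 2) × (↥Aᶜ → Fin 2) :=
  Equiv.piEquivPiSubtypeProd (· ∈ A) fun _ => Fin 2

/-- The operator acting as `F` on the qubits in `A` and as `H` on the others. -/
def bipartiteOp (F : Matrix (↥A → Fin 2) (↥A → Fin 2) ℂ)
    (H : Matrix (↥Aᶜ → Fin 2) (↥Aᶜ → Fin 2) ℂ) :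
    Matrix (Fin n → Fin 2) (Fin n → Fin 2) ℂ :=
  (F ⊗ₖ H).submatrix (splitEquiv A) (splitEquiv A)

theorem bipartiteOp_mul (F F' : Matrix (↥A → Fin 2) (↥A → Fin 2) ℂ)
    (H H' : Matrix (↥Aᶜ → Fin 2) (↥Aᶜ → Fin 2) ℂ) :
    bipartiteOp A F H * bipartiteOp A F' H' = bipartiteOp A (F * F') (H * H') := by
  rw [bipartiteOp, bipartiteOp, Matrix.submatrix_mul_equiv, ← Matrix.mul_kronecker_mul]
  rfl

theorem bipartiteOp_one : bipartiteOp A 1 1 = 1 := by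
  rw [bipartiteOp, Matrix.one_kronecker_one, Matrix.submatrix_one_equiv]

theorem bipartiteOp_mulVec (F : Matrix (↥A → Fin 2) (↥A → Fin 2) ℂ)
    (H : Matrix (↥Aᶜ → Fin 2) (↥Aᶜ → Fin 2) ℂ) (b : (↥A → Fin 2) → ℂ) (c : (↥Aᶜ → Fin 2) → ℂ)
    {v : (Fin n → Fin 2) → ℂ} (hv : ∀ x, v x = b (fun i => x i.1) * c (fun i => x i.1))
    (x : Fin n → Fin 2) :
    (bipartiteOp A F H *ᵥ v) x = (F *ᵥ b) (fun i => x i.1) * (H *ᵥ c) (fun i => x i.1) := by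
  simp only [Matrix.mulVec, dotProduct]
  rw [Finset.sum_mul_sum, ← Fintype.sum_prod_type', ← (splitEquiv A).sum_comp]
  refine Finset.sum_congr rfl fun y _ => ?_
  rw [hv y]
  exact mul_mul_mul_comm _ _ _ _

theorem pauliOp_eq_bipartiteOp (p : Fin n → Fin 4) :
    pauliOp p = bipartiteOp A (tensorMat fun k => pauliMat (p k))
      (tensorMat fun k => pauliMat (p k)) := by
  ext x y
  exact (Fintype.prod_subtype_mul_prod_subtype (· ∈ A)
    fun k => pauliMat (p k) (x k) (y k)).symm

variable {A}

theorem pauliOp_eq_bipartiteOp_one {p : Fin n → Fin 4} (hp : ∀ k, p k ≠ 0 → k ∈ A) :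
    pauliOp p = bipartiteOp A (tensorMat fun k => pauliMat (p k)) 1 := by
  have h : ∀ k : ↥Aᶜ, p k = 0 := fun k => not_not.mp fun hk => k.2 (hp k hk)
  rw [pauliOp_eq_bipartiteOp A, ← tensorMat_one]
  simp only [h]
  rfl

theorem pauliOp_eq_one_bipartiteOp {p : Fin n → Fin 4} (hp : ∀ k, p k ≠ 0 → k ∈ Aᶜ) :
    pauliOp p = bipartiteOp A 1 (tensorMat fun k => pauliMat (p k)) := by
  have h : ∀ k : ↥A, p k = 0 := fun k => not_not.mp fun hk => hp k hk k.2
  rw [pauliOp_eq_bipartiteOp A, ← tensorMat_one]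
  simp only [h]
  rfl

theorem exists_one_add_eq_bipartiteOp (ε : ℂ) {p : Fin n → Fin 4}
    (hp : (∀ k, p k ≠ 0 → k ∈ A) ∨ (∀ k, p k ≠ 0 → k ∈ Aᶜ)) :
    ∃ F H, 1 + ε • pauliOp p = bipartiteOp A F H := by
  obtain hp | hp := hp
  · refine ⟨1 + ε • tensorMat fun k : ↥A => pauliMat (p k), 1, ?_⟩
    rw [pauliOp_eq_bipartiteOp_one hp, ← bipartiteOp_one A]
    simp only [bipartiteOp, Matrix.add_kronecker, Matrix.smul_kronecker]
    rfl
  · refine ⟨1, 1 + ε • tensorMat fun k : ↥Aᶜ => pauliMat (p k), ?_⟩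
    rw [pauliOp_eq_one_bipartiteOp hp, ← bipartiteOp_one A]
    simp only [bipartiteOp, Matrix.kronecker_add, Matrix.kronecker_smul]
    rfl

theorem exists_list_prod_eq_bipartiteOp (l : List (Matrix (Fin n → Fin 2) (Fin n → Fin 2) ℂ))
    (hl : ∀ M ∈ l, ∃ F H, M = bipartiteOp A F H) : ∃ F H, l.prod = bipartiteOp A F H := by
  induction l with
  | nil => exact ⟨1, 1, (bipartiteOp_one A).symm⟩
  | cons M l ih =>
    obtain ⟨F, H, hM⟩ := hl M List.mem_cons_self
    obtain ⟨F', H', hl'⟩ := ih fun N hN => hl N (List.mem_cons_of_mem M hN)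
    exact ⟨F * F', H * H', by rw [List.prod_cons, hM, hl', bipartiteOp_mul]⟩

theorem SeparableAcross.of_vecMulVec {v w : (Fin n → Fin 2) → ℂ} (hw : w ≠ 0)
    {F : Matrix (↥A → Fin 2) (↥A → Fin 2) ℂ} {H : Matrix (↥Aᶜ → Fin 2) (↥Aᶜ → Fin 2) ℂ}
    (h : Matrix.vecMulVec v w = bipartiteOp A F H) : SeparableAcross v A := by
  obtain ⟨y, hy⟩ := Function.ne_iff.mp hw
  refine ⟨fun x => F x (fun i => y i.1) / w y, fun x => H x (fun i => y i.1), fun x => ?_⟩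
  have hxy : v x * w y =
      F (fun i => x i.1) (fun i => y i.1) * H (fun i => x i.1) (fun i => y i.1) :=
    congrFun (congrFun h x) y
  rw [div_mul_eq_mul_div, ← hxy, mul_div_cancel_right₀ _ hy]

theorem SeparableAcross.exists_pauliOp_mulVec {v : (Fin n → Fin 2) → ℂ} (hv : v ≠ 0)
    (hsep : SeparableAcross v A) {ε : ℂ} {p q : Fin n → Fin 4}
    (hfix : (ε • pauliOp p) *ᵥ v = v) (hq : ∀ k, q k = if k ∈ A then p k else 0) :
    ∃ κ : ℂ, κ * κ = 1 ∧ (κ • pauliOp q) *ᵥ v = v := by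
  obtain ⟨b, c, hbc⟩ := hsep
  have hqA : pauliOp q = bipartiteOp A (tensorMat fun k => pauliMat (p k)) 1 := by
    rw [pauliOp_eq_bipartiteOp_one (A := A) fun k hk => by by_contra h; simp [hq, h] at hk]
    congr
    ext1 k
    rw [hq, if_pos k.2]
  obtain ⟨y, hy⟩ := Function.ne_iff.mp hv
  rw [hbc y] at hy
  have hcy : c (fun i => y i.1) ≠ 0 := right_ne_zero_of_mul hy
  set F := tensorMat fun k : ↥A => pauliMat (p k)
  set H := tensorMat fun k : ↥Aᶜ => pauliMat (p k)
  set κ := ε * (H *ᵥ c) (fun i => y i.1) / c (fun i => y i.1) with hκ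
  have hb : ∀ x, b x = κ * (F *ᵥ b) x := by
    intro x
    obtain ⟨z, hz⟩ := (splitEquiv A).surjective (x, fun i => y i.1)
    have hzx : (fun i : ↥A => z i.1) = x := congrArg Prod.fst hz
    have hzy : (fun i : ↥Aᶜ => z i.1) = fun i => y i.1 := congrArg Prod.snd hz
    have hz' := congrFun hfix z
    rw [Matrix.smul_mulVec, Pi.smul_apply, pauliOp_eq_bipartiteOp A,
      bipartiteOp_mulVec A _ _ b c hbc, hbc z, hzx, hzy, smul_eq_mul] at hz'
    rw [hκ, div_mul_eq_mul_div, eq_div_iff hcy, ← hz']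
    ring
  have hκv : (κ • pauliOp q) *ᵥ v = v := by
    ext x
    rw [Matrix.smul_mulVec, Pi.smul_apply, hqA, bipartiteOp_mulVec A _ _ b c hbc,
      Matrix.one_mulVec, hbc x, hb, smul_eq_mul, mul_assoc]
  refine ⟨κ, ?_, hκv⟩
  have h2 : ((κ * κ) • (1 : Matrix (Fin n → Fin 2) (Fin n → Fin 2) ℂ)) *ᵥ v = v := by
    rw [← pauliOp_mul_self q, ← smul_mul_smul_comm, ← Matrix.mulVec_mulVec, hκv, hκv]
  have h3 := congrFun h2 y
  rw [Matrix.smul_mulVec, Matrix.one_mulVec, Pi.smul_apply, smul_eq_mul, hbc y] at h3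
  exact mul_right_cancel₀ hy (h3.trans (one_mul _).symm)

end bipartite

section supported

variable {n : ℕ} {v : (Fin n → Fin 2) → ℂ}

/-- `σ` is a signed Pauli string acting trivially outside `A`. -/
def SignedPauliSupportedOn (A : Set (Fin n))
    (σ : Matrix (Fin n → Fin 2) (Fin n → Fin 2) ℂ) : Prop :=
  ∃ (ε : ℂ) (p : Fin n → Fin 4), (ε = 1 ∨ ε = -1) ∧ σ = ε • pauliOp p ∧ ∀ k, p k ≠ 0 → k ∈ A

theorem SeparableAcross.exists_mul_eq {A : Set (Fin n)} (hv : v ≠ 0) (hsep : SeparableAcross v A)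
    {σ : Matrix (Fin n → Fin 2) (Fin n → Fin 2) ℂ} (hσ : σ ∈ stabSet v) :
    ∃ σ₁ ∈ stabSet v, ∃ σ₂ ∈ stabSet v, SignedPauliSupportedOn A σ₁ ∧
      SignedPauliSupportedOn Aᶜ σ₂ ∧ σ₁ * σ₂ = σ := by
  classical
  have hσ' := hσ
  obtain ⟨⟨ε, p, hε, rfl⟩, hfix⟩ := hσ'
  let q : Fin n → Fin 4 := fun k => if k ∈ A then p k else 0
  let r : Fin n → Fin 4 := fun k => if k ∈ A then 0 else p k
  have hqr : pauliOp p = pauliOp q * pauliOp r := by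
    simp only [pauliOp_eq_tensorMat, tensorMat_mul]
    congr 1
    ext1 k
    by_cases hk : k ∈ A <;> simp [q, r, hk, pauliMat]
  obtain ⟨κ, hκ, hκv⟩ := hsep.exists_pauliOp_mulVec hv hfix (q := q) fun _ => rfl
  have hq : κ • pauliOp q ∈ stabSet v := ⟨⟨κ, q, mul_self_eq_one_iff.mp hκ, rfl⟩, hκv⟩
  have hr : (κ • pauliOp q) * (ε • pauliOp p) = (κ * ε) • pauliOp r := by
    rw [smul_mul_smul_comm, hqr, ← mul_assoc, pauliOp_mul_self, one_mul]
  refine ⟨_, hq, _, mul_mem_stabSet hv hq hσ,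
    ⟨κ, q, mul_self_eq_one_iff.mp hκ, rfl, fun k hk => ?_⟩,
    ⟨κ * ε, r, mul_self_eq_one_iff.mp ?_, hr, fun k hk => ?_⟩, ?_⟩
  · by_contra h
    simp [q, h] at hk
  · rw [mul_mul_mul_comm, hκ, mul_self_eq_one_iff.mpr hε, one_mul]
  · intro h
    simp [r, h] at hk
  · rw [← mul_assoc, mul_self_of_mem_stabSet hq, one_mul]

end supported

/-- A stabilizer state is separable across a bipartition `(A, Aᶜ)` iff
its tableau can be brought, by row operations (choice of generators), to block-diagonal
form: i.e. iff its stabilizer group admits a set of `n` generators each of which is a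
signed Pauli string supported entirely inside `A` or entirely inside `Aᶜ`. -/
theorem stmt9 (n : ℕ) (v : (Fin n → Fin 2) → ℂ) (hv : v ≠ 0)
    (hstabstate : (stabSet v).ncard = 2 ^ n) (A : Set (Fin n)) :
    SeparableAcross v A ↔
      ∃ g : Fin n → Matrix (Fin n → Fin 2) (Fin n → Fin 2) ℂ,
        (∀ i, g i ∈ stabSet v ∧
          ∃ (ε : ℂ) (p : Fin n → Fin 4), (ε = 1 ∨ ε = -1) ∧ g i = ε • pauliOp p ∧
            ((∀ k, p k ≠ 0 → k ∈ A) ∨ (∀ k, p k ≠ 0 → k ∈ Aᶜ))) ∧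
        (∀ σ ∈ stabSet v, ∃ f : Fin n → Bool,
          σ = (List.ofFn (fun i => if f i then g i else 1)).prod) := by
  constructor
  · intro hsep
    let := stabCommGroup hv
    let T : Set (stabSubmonoid hv) :=
      {σ | SignedPauliSupportedOn A σ.1 ∨ SignedPauliSupportedOn Aᶜ σ.1}
    have hT : Subgroup.closure T = ⊤ := by
      refine (Subgroup.eq_top_iff' _).mpr fun σ => ?_
      obtain ⟨σ₁, h₁, σ₂, h₂, hs₁, hs₂, hσ⟩ := hsep.exists_mul_eq hv σ.2
      have hmul : σ = (⟨σ₁, h₁⟩ * ⟨σ₂, h₂⟩ : stabSubmonoid hv) := Subtype.ext hσ.symm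
      rw [hmul]
      exact mul_mem (Subgroup.subset_closure (Or.inl hs₁)) (Subgroup.subset_closure (Or.inr hs₂))
    obtain ⟨g, hg, hgen⟩ := exists_subset_prod_generators
      (fun σ : stabSubmonoid hv => Subtype.ext (mul_self_of_mem_stabSet σ.2))
      ((natCard_stabSubmonoid hv).trans hstabstate) hT
    refine ⟨fun i => (g i).1, fun i => ⟨(g i).2, ?_⟩, fun σ hσ => ?_⟩
    · obtain ⟨ε, p, hε, hp, hA⟩ | ⟨ε, p, hε, hp, hA⟩ := hg i
      · exact ⟨ε, p, hε, hp, Or.inl hA⟩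
      · exact ⟨ε, p, hε, hp, Or.inr hA⟩
    · obtain ⟨f, hf⟩ := hgen ⟨σ, hσ⟩
      refine ⟨f, ?_⟩
      rw [← List.prod_ofFn] at hf
      have h := congrArg (stabSubmonoid hv).subtype hf
      rw [map_list_prod, List.map_ofFn] at h
      refine h.trans (congrArg (fun l => (List.ofFn l).prod) (funext fun i => ?_))
      simp only [Function.comp_apply]
      split_ifs <;> rfl
  · rintro ⟨g, hg, hgen⟩
    classical
    have hfin : Finite (stabSubmonoid hv) := Nat.finite_of_card_ne_zero
      (by rw [natCard_stabSubmonoid, hstabstate]; positivity)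
    have := Fintype.ofFinite (stabSubmonoid hv)
    obtain ⟨w, hw, hsum⟩ := exists_sum_stabSubmonoid_eq_vecMulVec hv hstabstate
    let subsetProd : (Fin n → Bool) → stabSubmonoid hv := fun f =>
      ⟨(List.ofFn fun i => if f i then g i else 1).prod, list_prod_mem fun M hM => by
        obtain ⟨i, rfl⟩ := List.mem_ofFn.mp hM
        split_ifs
        · exact (hg i).1
        · exact one_mem _⟩
    have hbij : Function.Bijective subsetProd := by
      refine (Fintype.bijective_iff_surjective_and_card _).mpr ⟨fun σ => ?_, ?_⟩
      · obtain ⟨f, hf⟩ := hgen σ.1 σ.2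
        exact ⟨f, Subtype.ext hf.symm⟩
      · rw [← Nat.card_eq_fintype_card (α := stabSubmonoid hv), natCard_stabSubmonoid, hstabstate]
        simp
    obtain ⟨F, H, hFH⟩ := exists_list_prod_eq_bipartiteOp (A := A)
      (List.ofFn fun i => 1 + g i) fun M hM => by
        obtain ⟨i, rfl⟩ := List.mem_ofFn.mp hM
        obtain ⟨-, ε, p, -, hp, hA⟩ := hg i
        rw [hp]
        exact exists_one_add_eq_bipartiteOp ε hA
    refine SeparableAcross.of_vecMulVec hw (F := F) (H := H) ?_
    rw [← hsum, ← hFH, prod_ofFn_one_add]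
    exact (hbij.sum_comp fun σ => σ.1).symm
end
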